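/- Let r ∈ [1, ∞) and let (a_m)_{m=1}^∞ be a sequence of real numbers with a_m ≥ 1/3 for all m. Then for every n and every y ∈ 𝕀^n with |y| ≥ n − a_n, one has ‖V_r(S_k χ_y : k ∈ {0,1,...,n})‖_2 ≥ (2/3) ⌊n/(3a_n)⌋^{1/r} ‖χ_y‖_2. -/

import Mathlib

open scoped ENNReal

/-- The spherical mean of radius `k` on the hypercube `{0,1}^n`. -/
noncomputable def sphMean (n k : ℕ) (f : (Fin n → Bool) → ℂ) (x : Fin n → Bool) : ℂ :=
  ((n.choose k : ℂ))⁻¹ * ∑ y ∈ Finset.univ.filter (fun y => hammingDist x y = k), f y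

/-- The `r`-variation seminorm of `a` over the index set `Z`, valued in `[0,∞]`. -/
noncomputable def eVar {ι : Type*} [LinearOrder ι] (r : ℝ) (a : ι → ℂ) (Z : Set ι) : ℝ≥0∞ :=
  ⨆ (J : ℕ) (t : Fin (J + 1) → ι) (_ : StrictMono t) (_ : ∀ j, t j ∈ Z),
    (∑ j : Fin J, (ENNReal.ofReal ‖a (t j.castSucc) - a (t j.succ)‖) ^ r) ^ r⁻¹

/-- The `ℓ²` norm of a `[0,∞]`-valued function on the hypercube. -/
noncomputable def eL2 {n : ℕ} (V : (Fin n → Bool) → ℝ≥0∞) : ℝ≥0∞ :=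
  (∑ x : Fin n → Bool, V x ^ (2 : ℝ)) ^ ((2 : ℝ))⁻¹

/-- The `ℓ²` norm of a complex function on the hypercube. -/
noncomputable def l2Norm {n : ℕ} (f : (Fin n → Bool) → ℂ) : ℝ :=
  Real.sqrt (∑ x : Fin n → Bool, ‖f x‖ ^ 2)

/-- The length (number of ones) of an element of the hypercube. -/
def wt {n : ℕ} (x : Fin n → Bool) : ℕ := (Finset.univ.filter (fun j => x j = true)).card

/-- The character `χ_y(x) = (-1)^{x·y}` on the hypercube. -/
noncomputable def chi {n : ℕ} (y x : Fin n → Bool) : ℂ :=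
  (-1) ^ ((Finset.univ.filter (fun j => x j = true ∧ y j = true)).card)

lemma aux_prod {n : ℕ} (p : Fin n → Prop) [DecidablePred p] {R : Type*} [CommRing R] :
    (-1 : R) ^ (Finset.univ.filter p).card = ∏ j, if p j then (-1 : R) else 1 := by
  rw [← Finset.prod_filter, Finset.prod_const]

lemma chi_rel {n : ℕ} (y x w : Fin n → Bool) :
    chi y w = chi y x * (-1) ^ (hammingDist x w) *
      (((-1 : ℝ) ^ (Finset.univ.filter (fun j => x j ≠ w j ∧ y j = false)).card : ℝ) : ℂ) := by
  unfold chi hammingDist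
  push_cast
  rw [aux_prod, aux_prod, aux_prod, aux_prod, ← Finset.prod_mul_distrib, ← Finset.prod_mul_distrib]
  refine Finset.prod_congr rfl fun j _ => ?_
  cases x j <;> cases w j <;> cases y j <;> simp

lemma norm_chi {n : ℕ} (y x : Fin n → Bool) : ‖chi y x‖ = 1 := by
  simp [chi]

/-- Point of the cube from a point and a set of flipped coordinates. -/
lemma sphere_card {n : ℕ} (k : ℕ) (x : Fin n → Bool) (A : Finset (Fin n)) :
    (Finset.univ.filter (fun w : Fin n → Bool =>
      hammingDist x w = k ∧ ∀ j, x j ≠ w j → j ∈ A)).card = A.card.choose k := by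
  rw [← Finset.card_powersetCard]
  refine Finset.card_nbij' (fun w => Finset.univ.filter (fun j => x j ≠ w j))
    (fun s j => if j ∈ s then !(x j) else x j) ?_ ?_ ?_ ?_
  · intro w hw
    simp only [Finset.coe_filter, Finset.mem_univ, true_and, Set.mem_ofPred_eq] at hw
    simp only [Finset.mem_coe, Finset.mem_powersetCard]
    refine ⟨fun j hj => hw.2 j (by simpa using hj), hw.1⟩
  · intro s hs
    simp only [Finset.mem_coe, Finset.mem_powersetCard] at hs
    simp only [Finset.coe_filter, Finset.mem_univ, true_and, Set.mem_ofPred_eq]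
    have h : ∀ j, (x j ≠ if j ∈ s then !(x j) else x j) ↔ j ∈ s := by
      intro j
      by_cases h : j ∈ s <;> simp [h]
    refine ⟨?_, fun j hj => hs.1 ((h j).1 hj)⟩
    unfold hammingDist
    simp only [h]
    simpa using hs.2
  · intro w _
    funext j
    simp only [Finset.mem_filter, Finset.mem_univ, true_and]
    cases x j <;> cases w j <;> simp
  · intro s _
    ext j
    by_cases h : j ∈ s <;> simp [h]

lemma sphere_card_univ {n : ℕ} (k : ℕ) (x : Fin n → Bool) :
    (Finset.univ.filter (fun w : Fin n → Bool => hammingDist x w = k)).card = n.choose k := by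
  simpa using sphere_card k x Finset.univ

lemma sphere_card_mem {n : ℕ} (k : ℕ) (hk : k ≤ n) (x : Fin n → Bool) (j : Fin n) :
    (n : ℝ) * ((Finset.univ.filter (fun w : Fin n → Bool => hammingDist x w = k)).filter
      (fun w => x j ≠ w j)).card = k * n.choose k := by
  have h1 := Finset.card_filter_add_card_filter_not
    (s := Finset.univ.filter (fun w : Fin n → Bool => hammingDist x w = k))
    (fun w => x j ≠ w j)
  rw [sphere_card_univ] at h1
  have h2 : ((Finset.univ.filter (fun w : Fin n → Bool => hammingDist x w = k)).filter
      (fun w => ¬ x j ≠ w j)).card = (n-1).choose k := by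
    have := sphere_card k x (Finset.univ.erase j)
    rw [Finset.card_erase_of_mem (Finset.mem_univ j)] at this
    simp only [Finset.card_univ, Fintype.card_fin] at this
    rw [← this, Finset.filter_filter]
    congr 1
    ext w
    simp only [Finset.mem_filter, Finset.mem_univ, true_and, Finset.mem_erase, and_true]
    refine and_congr_right fun _ => ⟨fun h i hi hij => h (hij ▸ hi), fun h hj => h j hj rfl⟩
  rw [h2] at h1
  obtain ⟨m, rfl⟩ : ∃ m, n = m + 1 := ⟨n - 1, by have := j.2; omega⟩
  have h3 := Nat.choose_mul_succ_eq m k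
  simp only [Nat.add_sub_cancel] at h1
  have h3' : (m.choose k : ℝ) * (m + 1) = (m+1).choose k * ((m:ℝ) + 1 - k) := by
    have := congrArg (Nat.cast : ℕ → ℝ) h3
    rw [Nat.cast_mul, Nat.cast_mul, Nat.cast_sub hk] at this
    push_cast at this
    exact this
  have h1' := congrArg (Nat.cast : ℕ → ℝ) h1
  push_cast at h1' ⊢
  linear_combination ((m:ℝ)+1) * h1' - h3'

/-- Normalized alternating sum. -/
noncomputable def cc {n : ℕ} (y : Fin n → Bool) (k : ℕ) (x : Fin n → Bool) : ℝ :=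
  ((n.choose k : ℝ))⁻¹ * ∑ w ∈ Finset.univ.filter (fun w => hammingDist x w = k),
    (-1 : ℝ) ^ (Finset.univ.filter (fun j => x j ≠ w j ∧ y j = false)).card

lemma sphMean_chi {n : ℕ} (y : Fin n → Bool) (k : ℕ) (x : Fin n → Bool) :
    sphMean n k (chi y) x = chi y x * (-1) ^ k * (cc y k x : ℂ) := by
  unfold sphMean cc
  push_cast
  rw [mul_left_comm (chi y x * (-1) ^ k)]
  congr 1
  rw [Finset.mul_sum]
  refine Finset.sum_congr rfl ?_
  intro w hw
  rw [chi_rel y x w, (Finset.mem_filter.1 hw).2]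
  push_cast
  rfl

lemma pow_bound (N : ℕ) : 1 - 2 * (N : ℝ) ≤ (-1) ^ N := by
  rcases Nat.eq_zero_or_pos N with rfl | h
  · simp
  · have : (1 : ℝ) ≤ N := by exact_mod_cast h
    rcases neg_one_pow_eq_or ℝ N with h | h <;> rw [h] <;> linarith

lemma wt_compl {n : ℕ} (y : Fin n → Bool) :
    ((Finset.univ.filter (fun j => y j = false)).card : ℝ) = n - wt y := by
  have := Finset.card_filter_add_card_filter_not (s := (Finset.univ : Finset (Fin n)))
    (fun j => y j = true)
  simp only [Bool.not_eq_true, Finset.card_univ, Fintype.card_fin] at this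
  unfold wt
  rw [eq_sub_iff_add_eq']
  exact_mod_cast this

lemma cc_bound {n : ℕ} (hn : 1 ≤ n) (y : Fin n → Bool) (k : ℕ) (hk : k ≤ n) (x : Fin n → Bool) :
    1 - 2 * (k * ((n : ℝ) - wt y) / n) ≤ cc y k x := by
  have hn0 : (0 : ℝ) < n := by exact_mod_cast hn
  have hC : (0 : ℝ) < n.choose k := by exact_mod_cast Nat.choose_pos hk
  unfold cc
  rw [inv_mul_eq_div, le_div_iff₀ hC]
  have h1 : ∑ w ∈ Finset.univ.filter (fun w => hammingDist x w = k),
      (1 - 2 * ((Finset.univ.filter (fun j => x j ≠ w j ∧ y j = false)).card : ℝ)) ≤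
      ∑ w ∈ Finset.univ.filter (fun w => hammingDist x w = k),
    (-1 : ℝ) ^ (Finset.univ.filter (fun j => x j ≠ w j ∧ y j = false)).card :=
    Finset.sum_le_sum fun w _ => pow_bound _
  refine le_trans (le_of_eq ?_) h1
  rw [Finset.sum_sub_distrib, ← Finset.mul_sum, Finset.sum_const, sphere_card_univ]
  have h2 : ∑ w ∈ Finset.univ.filter (fun w => hammingDist x w = k),
      ((Finset.univ.filter (fun j => x j ≠ w j ∧ y j = false)).card : ℝ) =
      ∑ j ∈ Finset.univ.filter (fun j => y j = false),
        (((Finset.univ.filter (fun w : Fin n → Bool => hammingDist x w = k)).filter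
      (fun w => x j ≠ w j)).card : ℝ) := by
    have := Finset.sum_card_bipartiteAbove_eq_sum_card_bipartiteBelow
      (s := Finset.univ.filter (fun w : Fin n → Bool => hammingDist x w = k))
      (t := Finset.univ.filter (fun j => y j = false)) (fun w j => x j ≠ w j)
    simp only [Finset.bipartiteAbove, Finset.bipartiteBelow] at this
    rw [← Nat.cast_sum, ← Nat.cast_sum, ← this]
    congr 1
    refine Finset.sum_congr rfl fun w _ => ?_
    congr 1
    ext j
    simp [and_comm]
  have h3 : ∀ j : Fin n, (((Finset.univ.filter (fun w : Fin n → Bool =>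
      hammingDist x w = k)).filter (fun w => x j ≠ w j)).card : ℝ) = k * n.choose k / n := by
    intro j
    rw [eq_div_iff hn0.ne', mul_comm, sphere_card_mem k hk x j]
  rw [h2, Finset.sum_congr rfl (fun j _ => h3 j), Finset.sum_const, nsmul_eq_mul, nsmul_eq_mul, wt_compl]
  field_simp

/-- Counterexample: for `|y| ≥ n - a_n` with `a_m ≥ 1/3`, the `r`-variation of `S_k χ_y`
has `ℓ²` norm at least `(2/3)⌊n/(3a_n)⌋^{1/r} ‖χ_y‖₂`. -/
theorem statement3 (r : ℝ) (hr : 1 ≤ r) (a : ℕ → ℝ) (ha : ∀ m, 1 ≤ m → 1 / 3 ≤ a m)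
    (n : ℕ) (hn : 1 ≤ n) (y : Fin n → Bool) (hy : (n : ℝ) - a n ≤ (wt y : ℝ)) :
    ENNReal.ofReal (2 / 3 * (⌊(n : ℝ) / (3 * a n)⌋₊ : ℝ) ^ (1 / r) * l2Norm (chi y)) ≤
      eL2 (fun x => eVar r (fun k => sphMean n k (chi y) x) (Set.Iic n)) := by
  have hn0 : (0 : ℝ) < n := by exact_mod_cast hn
  have han := ha n hn
  have hr0 : 0 < r := by linarith
  set K := ⌊(n : ℝ) / (3 * a n)⌋₊ with hK
  have hKle : (K : ℝ) ≤ n / (3 * a n) := Nat.floor_le (by positivity)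
  have hKa : (K : ℝ) * (3 * a n) ≤ n := (le_div_iff₀ (by linarith)).1 hKle
  have hKn : K ≤ n := by
    have : (K : ℝ) ≤ n := by nlinarith [(Nat.cast_nonneg K : (0:ℝ) ≤ K)]
    exact_mod_cast this
  have hc : ∀ k ≤ K, ∀ x, 1 / 3 ≤ cc y k x := by
    intro k hk x
    refine le_trans ?_ (cc_bound hn y k (hk.trans hKn) x)
    have hk' : (k : ℝ) ≤ K := by exact_mod_cast hk
    have : (k : ℝ) * ((n : ℝ) - wt y) / n ≤ 1 / 3 := by
      rw [div_le_iff₀ hn0]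
      have h0 : (0:ℝ) ≤ k := Nat.cast_nonneg k
      have h1 : (k : ℝ) * ((n : ℝ) - wt y) ≤ k * a n :=
        mul_le_mul_of_nonneg_left (by linarith) h0
      have h2 : (k : ℝ) * a n ≤ K * a n := mul_le_mul_of_nonneg_right hk' (by linarith)
      linarith
    linarith
  have hV : ∀ x, ENNReal.ofReal (2 / 3 * (K : ℝ) ^ (1 / r)) ≤
      eVar r (fun k => sphMean n k (chi y) x) (Set.Iic n) := by
    intro x
    unfold eVar
    refine le_iSup_of_le K (le_iSup_of_le (fun j => (j : ℕ)) (le_iSup_of_le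
      (fun _ _ h => h) (le_iSup_of_le (fun j => ?_) ?_)))
    · have := j.2
      simp only [Set.mem_Iic]
      omega
    · have hterm : ∀ j : Fin K, ENNReal.ofReal (2 / 3) ^ r ≤
          ENNReal.ofReal ‖sphMean n (j.castSucc : Fin (K+1)) (chi y) x -
            sphMean n (j.succ : Fin (K+1)) (chi y) x‖ ^ r := by
        intro j
        refine ENNReal.rpow_le_rpow (ENNReal.ofReal_le_ofReal ?_) hr0.le
        rw [sphMean_chi, sphMean_chi]
        have e : chi y x * (-1) ^ ((j.castSucc : Fin (K+1)) : ℕ) *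
            (cc y ((j.castSucc : Fin (K+1)) : ℕ) x : ℂ) -
            chi y x * (-1) ^ ((j.succ : Fin (K+1)) : ℕ) *
            (cc y ((j.succ : Fin (K+1)) : ℕ) x : ℂ) = chi y x * (-1) ^ (j : ℕ) *
            ((cc y j x + cc y (j + 1) x : ℝ) : ℂ) := by
          simp only [Fin.val_castSucc, Fin.val_succ]
          push_cast
          ring
        rw [e, norm_mul, norm_mul, norm_chi, norm_pow, norm_neg, norm_one, one_pow, one_mul,
          one_mul, Complex.norm_real]
        have h1 := hc j j.2.le x
        have h2 := hc (j + 1) j.2 x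
        exact le_trans (by linarith) (le_abs_self _)
      have hsum := Finset.sum_le_sum (s := Finset.univ) fun j _ => hterm j
      refine le_trans (le_of_eq ?_) (ENNReal.rpow_le_rpow hsum (inv_nonneg.2 hr0.le))
      rw [Finset.sum_const, Finset.card_univ, Fintype.card_fin, nsmul_eq_mul,
        ENNReal.mul_rpow_of_nonneg _ _ (inv_nonneg.2 hr0.le), ENNReal.rpow_rpow_inv hr0.ne',
        ENNReal.ofReal_mul (by norm_num), mul_comm, one_div r,
        ← ENNReal.ofReal_rpow_of_nonneg (Nat.cast_nonneg K) (inv_nonneg.2 hr0.le),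
        ENNReal.ofReal_natCast]
  unfold eL2
  have hsum := Finset.sum_le_sum (s := Finset.univ) fun x _ =>
    ENNReal.rpow_le_rpow (hV x) (zero_le_two : (0:ℝ) ≤ 2)
  refine le_trans (le_of_eq ?_) (ENNReal.rpow_le_rpow hsum (by norm_num))
  rw [Finset.sum_const, nsmul_eq_mul, ENNReal.mul_rpow_of_nonneg _ _ (by norm_num),
    ENNReal.rpow_rpow_inv (by norm_num), ENNReal.ofReal_mul (by positivity), mul_comm]
  congr 1
  unfold l2Norm
  simp only [norm_chi, one_pow, Finset.sum_const, nsmul_eq_mul, mul_one]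
  rw [Real.sqrt_eq_rpow, one_div,
    ← ENNReal.ofReal_rpow_of_nonneg (Nat.cast_nonneg _) (by norm_num), ENNReal.ofReal_natCast]
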